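/- Let J be a bounded self-adjoint Jacobi matrix on ℓ²(ℕ) with sup_n|b_n| + sup_n|a_n| + sup_n|a_n|^{-1} ≤ K, and let R denote its set of right limits (two-sided Jacobi matrices on ℓ²(ℤ) arising as limits of shifted parameters along subsequences tending to infinity). Then σ_ess(J) equals the closure of the union over J^{(r)} ∈ R of σ(J^{(r)}). -/

import Mathlib

open scoped InnerProductSpace
open Filter

/-- The canonical basis vector `δ_n` of `ℓ²(ℕ)`. -/
noncomputable def deltaN (n : ℕ) : lp (fun _ : ℕ => ℂ) 2 := lp.single 2 n 1

/-- The canonical basis vector `δ_n` of `ℓ²(ℤ)`. -/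
noncomputable def deltaZ (n : ℤ) : lp (fun _ : ℤ => ℂ) 2 := lp.single 2 n 1

/-- Half-line Jacobi matrix entries. -/
noncomputable def jacEntryN (a b : ℕ → ℝ) (n m : ℕ) : ℂ :=
  if m = n + 1 then (a n : ℂ) else if n = m + 1 then (a m : ℂ)
  else if n = m then (b n : ℂ) else 0

/-- Whole-line Jacobi matrix entries. -/
noncomputable def jacEntryZ (a b : ℤ → ℝ) (n m : ℤ) : ℂ :=
  if m = n + 1 then (a n : ℂ) else if n = m + 1 then (a m : ℂ)
  else if n = m then (b n : ℂ) else 0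

/-- `(ar, br)` are the parameters of a right limit of the half-line Jacobi parameters. -/
def IsRightLimit (a b : ℕ → ℝ) (ar br : ℤ → ℝ) : Prop :=
  ∃ n : ℕ → ℕ, StrictMono n ∧ ∀ ℓ : ℤ,
    Tendsto (fun j => a (((n j : ℤ) + ℓ).toNat)) atTop (nhds (ar ℓ)) ∧
    Tendsto (fun j => b (((n j : ℤ) + ℓ).toNat)) atTop (nhds (br ℓ))

/-- The essential spectrum: the intersection of the spectra of all compact perturbations. -/
noncomputable def essSpec {H : Type*} [NormedAddCommGroup H] [InnerProductSpace ℂ H]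
    [CompleteSpace H] (A : H →L[ℂ] H) : Set ℂ :=
  ⋂ K : {K : H →L[ℂ] H // IsCompactOperator ⇑K}, spectrum ℂ (A + K.1)

section Hilbert

variable {H : Type*} [NormedAddCommGroup H] [InnerProductSpace ℂ H]

theorem exists_bound_of_notMem_spectrum {T : H →L[ℂ] H} {z : ℂ} (hz : z ∉ spectrum ℂ T) :
    ∃ c > 0, ∀ v, c * ‖v‖ ≤ ‖T v - z • v‖ := by
  obtain ⟨u, hu⟩ := spectrum.notMem_iff.mp hz
  refine ⟨(‖(↑u⁻¹ : H →L[ℂ] H)‖ + 1)⁻¹, by positivity, fun v => ?_⟩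
  have h1 : (↑u⁻¹ : H →L[ℂ] H) (z • v - T v) = v := by
    have : (↑u⁻¹ * ↑u : H →L[ℂ] H) v = v := by simp
    rw [hu] at this
    simpa [Algebra.algebraMap_eq_smul_one] using this
  have h2 := (↑u⁻¹ : H →L[ℂ] H).le_opNorm (z • v - T v)
  rw [h1, norm_sub_rev] at h2
  rw [inv_mul_le_iff₀ (by positivity)]
  nlinarith [norm_nonneg (T v - z • v)]

theorem tendsto_norm_sum_smul {ι H' : Type*} [NormedAddCommGroup H'] [InnerProductSpace ℂ H']
    (s : Finset ι) {x : ℕ → ι → H} {y : ι → H'} {c : ℕ → ι → ℂ} {d : ι → ℂ}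
    (hxy : ∀ i k, Tendsto (fun j => ⟪x j i, x j k⟫_ℂ) atTop (nhds ⟪y i, y k⟫_ℂ))
    (hc : ∀ i, Tendsto (fun j => c j i) atTop (nhds (d i))) :
    Tendsto (fun j => ‖∑ i ∈ s, c j i • x j i‖) atTop (nhds ‖∑ i ∈ s, d i • y i‖) := by
  simp_rw [norm_eq_sqrt_re_inner (𝕜 := ℂ), sum_inner, inner_sum, inner_smul_left, inner_smul_right]
  refine (Real.continuous_sqrt.tendsto _).comp ((RCLike.continuous_re.tendsto _).comp ?_)
  refine tendsto_finsetSum _ fun i _ => tendsto_finsetSum _ fun k _ => ?_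
  exact ((Complex.continuous_conj.tendsto _).comp (hc i)).mul ((hc k).mul (hxy i k))

variable [CompleteSpace H]

theorem isUnit_of_bounded_below {A : H →L[ℂ] H} {c : ℝ} (hc : 0 < c)
    (h : ∀ v, c * ‖v‖ ≤ ‖A v‖) (h' : ∀ v, c * ‖v‖ ≤ ‖A.adjoint v‖) : IsUnit A := by
  rw [ContinuousLinearMap.isUnit_iff_bijective,
    ContinuousLinearMap.bijective_iff_dense_range_and_antilipschitz]
  refine ⟨?_, c⁻¹.toNNReal, ?_⟩
  · have hbot : A.rangeᗮ = ⊥ := by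
      rw [ContinuousLinearMap.orthogonal_range, Submodule.eq_bot_iff]
      intro v hv
      have h0 : A.adjoint v = 0 := hv
      have := h' v
      rw [h0, norm_zero] at this
      exact norm_eq_zero.mp (le_antisymm (by nlinarith [norm_nonneg v]) (norm_nonneg v))
    rwa [Submodule.topologicalClosure_eq_top_iff]
  · refine ContinuousLinearMap.antilipschitz_of_bound _ fun v => ?_
    have := h v
    rw [Real.coe_toNNReal _ (by positivity), inv_mul_eq_div, le_div_iff₀ hc]
    linarith

theorem IsSelfAdjoint.isStarNormal_algebraMap_sub {T : H →L[ℂ] H} (hT : IsSelfAdjoint T) (z : ℂ) :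
    IsStarNormal (algebraMap ℂ (H →L[ℂ] H) z - T) := by
  refine ⟨?_⟩
  rw [star_sub, hT.star_eq, ← algebraMap_star_comm]
  exact (Algebra.commute_algebraMap_left _ _).sub_left
    ((Algebra.commute_algebraMap_right _ _).sub_right (Commute.refl T))

theorem IsSelfAdjoint.mul_norm_le_norm_sub_smul {T : H →L[ℂ] H} (hT : IsSelfAdjoint T) {z : ℂ}
    {ε : ℝ} (hε : 0 < ε) (h : ∀ w ∈ spectrum ℂ T, ε ≤ dist z w) (v : H) :
    ε * ‖v‖ ≤ ‖T v - z • v‖ := by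
  have hz : z ∉ spectrum ℂ T := fun hz => by
    have := h z hz
    rw [dist_self] at this
    linarith
  obtain ⟨u, hu⟩ := spectrum.notMem_iff.mp hz
  have hnT : IsStarNormal T := hT.isStarNormal
  have hnu : IsStarNormal (u : H →L[ℂ] H) := by
    rw [hu]
    exact hT.isStarNormal_algebraMap_sub z
  have hnu' : IsStarNormal u := ⟨Units.ext hnu.star_comm_self⟩
  have hni : IsStarNormal (↑u⁻¹ : H →L[ℂ] H) := by
    refine ⟨?_⟩
    have h1 := hnu'.star_comm_self.inv_inv
    have h2 := congrArg Units.val h1.eq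
    simpa [commute_iff_eq] using h2
  have hbound : ‖(↑u⁻¹ : H →L[ℂ] H)‖ ≤ ε⁻¹ := by
    have hr := IsStarNormal.spectralRadius_eq_nnnorm (↑u⁻¹ : H →L[ℂ] H)
    have hle : spectralRadius ℂ (↑u⁻¹ : H →L[ℂ] H) ≤
        (ε⁻¹.toNNReal : ENNReal) := by
      refine iSup₂_le fun k hk => ?_
      rw [← spectrum.map_inv, Set.mem_inv, hu] at hk
      have hk' : z - k⁻¹ ∈ spectrum ℂ T := by
        rw [spectrum.mem_iff] at hk ⊢
        rw [← IsUnit.neg_iff] at hk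
        convert hk using 2
        rw [map_sub]
        abel
      have := h _ hk'
      rw [dist_eq_norm, sub_sub_cancel, norm_inv] at this
      rw [ENNReal.coe_le_coe, ← NNReal.coe_le_coe, coe_nnnorm,
        Real.coe_toNNReal _ (by positivity)]
      exact (le_inv_comm₀ hε (inv_pos.mp (hε.trans_le this))).mp this
    rw [hr, ENNReal.coe_le_coe, ← NNReal.coe_le_coe,
      Real.coe_toNNReal _ (by positivity)] at hle
    exact hle
  have h1 : (↑u⁻¹ : H →L[ℂ] H) (z • v - T v) = v := by
    have : (↑u⁻¹ * ↑u : H →L[ℂ] H) v = v := by simp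
    rw [hu] at this
    simpa [Algebra.algebraMap_eq_smul_one] using this
  have h2 := (↑u⁻¹ : H →L[ℂ] H).le_of_opNorm_le hbound (z • v - T v)
  rwa [h1, norm_sub_rev, ← div_eq_inv_mul, le_div_iff₀ hε, mul_comm] at h2

theorem IsSelfAdjoint.notMem_spectrum_of_bounded_below {T : H →L[ℂ] H} (hT : IsSelfAdjoint T)
    {z : ℂ} {c : ℝ} (hc : 0 < c) (h : ∀ v, c * ‖v‖ ≤ ‖T v - z • v‖) : z ∉ spectrum ℂ T := by
  rw [spectrum.notMem_iff]
  have hn := hT.isStarNormal_algebraMap_sub z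
  have hA : ∀ v, c * ‖v‖ ≤ ‖(algebraMap ℂ (H →L[ℂ] H) z - T) v‖ := fun v => by
    simpa [Algebra.algebraMap_eq_smul_one, norm_sub_rev] using h v
  refine isUnit_of_bounded_below hc hA fun v => ?_
  rw [← ContinuousLinearMap.isStarNormal_iff_norm_eq_adjoint.mp hn]
  exact hA v

theorem bounded_below_add_smul_starProjection {A : H →L[ℂ] H} (hA : IsSelfAdjoint A)
    (V : Submodule ℂ H) [FiniteDimensional ℂ V] {c : ℝ} (hc : 0 < c)
    (h : ∀ u ∈ Vᗮ, c * ‖u‖ ≤ ‖A u‖) {σ : ℂ} (hσ : σ = Complex.I ∨ σ = -Complex.I) :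
    ∃ d > 0, ∀ u, d * ‖u‖ ≤ ‖(A + σ • V.starProjection) u‖ := by
  set M := 1 + ‖A‖ + c with hM
  have hσn : ‖σ‖ = 1 := by rcases hσ with rfl | rfl <;> simp
  refine ⟨(c / 2) / (1 + M ^ 2 / (2 * c)), by positivity, fun u => ?_⟩
  rw [div_mul_eq_mul_div, div_le_iff₀ (by positivity)]
  set y := (A + σ • V.starProjection) u with hy
  set p := V.starProjection u with hp
  have hyA : y = A u + σ • p := by simp [hy, hp]
  have hq : u - p ∈ Vᗮ := Submodule.sub_starProjection_mem_orthogonal u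
  have hup : ⟪u, p⟫_ℂ = (‖p‖ : ℂ) ^ 2 := by
    have hpV : p ∈ V := Submodule.starProjection_apply_mem V u
    have h0 : ⟪u - p, p⟫_ℂ = 0 := Submodule.inner_left_of_mem_orthogonal hpV hq
    rw [inner_sub_left, sub_eq_zero] at h0
    rw [h0, inner_self_eq_norm_sq_to_K]
    rfl
  have hAim : (⟪u, A u⟫_ℂ).im = 0 := by
    have := (ContinuousLinearMap.isSelfAdjoint_iff_isSymmetric.mp hA).im_inner_self_apply u
    simpa using this
  have hpy : ‖p‖ ^ 2 ≤ ‖u‖ * ‖y‖ := by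
    have h1 : |(⟪u, y⟫_ℂ).im| = ‖p‖ ^ 2 := by
      rw [hyA, inner_add_right, inner_smul_right, hup, Complex.add_im, hAim, zero_add]
      rw [← Complex.ofReal_pow]
      rcases hσ with rfl | rfl <;> simp [-Complex.ofReal_pow]
    rw [← h1]
    exact (Complex.abs_im_le_norm _).trans (norm_inner_le_norm _ _)
  have hAq : c * ‖u - p‖ ≤ ‖y‖ + (1 + ‖A‖) * ‖p‖ := by
    refine (h _ hq).trans ?_
    have : A (u - p) = y - σ • p - A p := by rw [hyA, map_sub]; abel
    rw [this]
    have h1 := norm_sub_le (y - σ • p) (A p)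
    have h2 := norm_sub_le y (σ • p)
    have h3 := A.le_opNorm p
    rw [norm_smul, hσn, one_mul] at h2
    linarith
  have hu : c * ‖u‖ ≤ ‖y‖ + M * ‖p‖ := by
    have : ‖u‖ ≤ ‖u - p‖ + ‖p‖ := by simpa using norm_add_le (u - p) p
    nlinarith
  rcases (norm_nonneg u).eq_or_lt with h0 | h0
  · rw [← h0]; simp; positivity
  refine le_of_mul_le_mul_right ?_ h0
  have hsq : M * ‖p‖ * ‖u‖ ≤ c / 2 * ‖u‖ ^ 2 + M ^ 2 / (2 * c) * ‖p‖ ^ 2 := by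
    have : c / 2 * ‖u‖ ^ 2 + M ^ 2 / (2 * c) * ‖p‖ ^ 2 - M * ‖p‖ * ‖u‖
        = (c * ‖u‖ - M * ‖p‖) ^ 2 / (2 * c) := by
      field_simp
      ring
    have h2 : 0 ≤ (c * ‖u‖ - M * ‖p‖) ^ 2 / (2 * c) := by positivity
    linarith
  have h3 : M ^ 2 / (2 * c) * ‖p‖ ^ 2 ≤ M ^ 2 / (2 * c) * (‖u‖ * ‖y‖) := by gcongr
  nlinarith

theorem notMem_essSpec_of_bounded_below_orthogonal {T : H →L[ℂ] H} (hT : IsSelfAdjoint T) {z : ℂ}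
    (V : Submodule ℂ H) [FiniteDimensional ℂ V] {c : ℝ} (hc : 0 < c)
    (h : ∀ u ∈ Vᗮ, c * ‖u‖ ≤ ‖T u - z • u‖) : z ∉ essSpec T := by
  intro hz
  have hz' : ∀ K : H →L[ℂ] H, IsCompactOperator K → z ∈ spectrum ℂ (T + K) := fun K hK =>
    Set.mem_iInter.mp hz ⟨K, hK⟩
  have hzT : z ∈ spectrum ℂ T := by simpa using hz' 0 isCompactOperator_zero
  have hre : z = z.re := hT.mem_spectrum_eq_re hzT
  have hA : IsSelfAdjoint (T - z • (1 : H →L[ℂ] H)) := by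
    refine hT.sub ?_
    rw [hre, isSelfAdjoint_iff, star_smul, star_one]
    simp
  obtain ⟨d₁, hd₁, h₁⟩ :=
    bounded_below_add_smul_starProjection hA V hc (by simpa using h) (Or.inl rfl)
  obtain ⟨d₂, hd₂, h₂⟩ :=
    bounded_below_add_smul_starProjection hA V hc (by simpa using h) (Or.inr rfl)
  have hadj : (T - z • (1 : H →L[ℂ] H) + Complex.I • V.starProjection).adjoint =
      T - z • (1 : H →L[ℂ] H) + (-Complex.I) • V.starProjection := by
    rw [← ContinuousLinearMap.star_eq_adjoint, star_add, hA.star_eq, star_smul,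
      (isSelfAdjoint_starProjection V).star_eq]
    simp
  have hunit : IsUnit (T - z • (1 : H →L[ℂ] H) + Complex.I • V.starProjection) := by
    refine isUnit_of_bounded_below (lt_min hd₁ hd₂) (fun v => ?_) (fun v => ?_)
    · exact (mul_le_mul_of_nonneg_right (min_le_left _ _) (norm_nonneg _)).trans (h₁ v)
    · rw [hadj]
      exact (mul_le_mul_of_nonneg_right (min_le_right _ _) (norm_nonneg _)).trans (h₂ v)
  have hcomp : IsCompactOperator (Complex.I • V.starProjection : H →L[ℂ] H) := by
    have h1 : IsCompactOperator (V.orthogonalProjectionOnto : H →L[ℂ] V) :=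
      isCompactOperator_of_locallyCompactSpace_dom _
    exact (h1.clm_comp V.subtypeL).smul Complex.I
  have := hz' _ hcomp
  rw [spectrum.mem_iff, ← IsUnit.neg_iff, Algebra.algebraMap_eq_smul_one] at this
  refine this ?_
  convert hunit using 1
  abel

theorem IsCompactOperator.tendsto_zero_of_weakly_tendsto_zero {T : H →L[ℂ] H}
    (hT : IsCompactOperator T) {x : ℕ → H} {r : ℝ} (hx : ∀ k, ‖x k‖ ≤ r)
    (hw : ∀ h : H, Tendsto (fun k => ⟪h, x k⟫_ℂ) atTop (nhds 0)) :
    Tendsto (fun k => T (x k)) atTop (nhds 0) := by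
  obtain ⟨C, hC, hsub⟩ := IsCompactOperator.image_closedBall_subset_compact
    (f := (T : H →ₗ[ℂ] H)) hT r
  refine hC.tendsto_nhds_of_unique_mapClusterPt (Eventually.of_forall fun k => hsub ?_) ?_
  · exact ⟨x k, by simpa using hx k, rfl⟩
  · intro y _ hy
    obtain ⟨φ, hφ, hlim⟩ := hy.tendsto_subseq
    have h1 : Tendsto (fun k => ⟪y, T (x (φ k))⟫_ℂ) atTop (nhds ⟪y, y⟫_ℂ) :=
      ((continuous_const.inner continuous_id).tendsto y).comp hlim
    have h2 : Tendsto (fun k => ⟪y, T (x (φ k))⟫_ℂ) atTop (nhds 0) := by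
      simp_rw [← ContinuousLinearMap.adjoint_inner_left]
      exact (hw _).comp hφ.tendsto_atTop
    exact inner_self_eq_zero.mp (tendsto_nhds_unique h1 h2)

end Hilbert

section Jacobi

local notation "ℓN" => lp (fun _ : ℕ => ℂ) 2
local notation "ℓZ" => lp (fun _ : ℤ => ℂ) 2

theorem inner_deltaN (n : ℕ) (u : ℓN) : ⟪deltaN n, u⟫_ℂ = u n := by
  rw [deltaN, lp.inner_single_left]
  simp

theorem inner_deltaZ (n : ℤ) (u : ℓZ) : ⟪deltaZ n, u⟫_ℂ = u n := by
  rw [deltaZ, lp.inner_single_left]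
  simp

theorem deltaN_apply (n m : ℕ) : deltaN n m = if m = n then 1 else 0 := by
  rw [deltaN, lp.single_apply, Pi.single_apply]

theorem deltaZ_apply (n m : ℤ) : deltaZ n m = if m = n then 1 else 0 := by
  rw [deltaZ, lp.single_apply, Pi.single_apply]

theorem hasSum_norm_sq {ι : Type*} (u : lp (fun _ : ι => ℂ) 2) :
    HasSum (fun i => ‖u i‖ ^ 2) (‖u‖ ^ 2) := by
  have := lp.hasSum_norm (p := 2) (by norm_num) u
  simpa using this

theorem norm_sum_deltaN_sq (s : Finset ℕ) (c : ℕ → ℂ) :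
    ‖∑ k ∈ s, c k • deltaN k‖ ^ 2 = ∑ k ∈ s, ‖c k‖ ^ 2 := by
  have := lp.norm_sum_single (p := 2) (E := fun _ : ℕ => ℂ) (by norm_num) c s
  simp only [deltaN, ← lp.single_smul, smul_eq_mul, mul_one]
  simpa using this

theorem jacobiN_delta_succ {a b : ℕ → ℝ} {J : ℓN →L[ℂ] ℓN}
    (hJ : ∀ n m, ⟪deltaN n, J (deltaN m)⟫_ℂ = jacEntryN a b n m) (m : ℕ) :
    J (deltaN (m + 1)) = (a m : ℂ) • deltaN m + (b (m + 1) : ℂ) • deltaN (m + 1)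
      + (a (m + 1) : ℂ) • deltaN (m + 2) := by
  refine lp.ext (funext fun n => ?_)
  rw [← inner_deltaN, hJ]
  simp only [lp.coeFn_add, lp.coeFn_smul, Pi.add_apply, Pi.smul_apply, deltaN_apply, smul_eq_mul,
    jacEntryN]
  split_ifs <;> first | omega | simp_all

theorem jacobiZ_delta {a b : ℤ → ℝ} {J : ℓZ →L[ℂ] ℓZ}
    (hJ : ∀ n m, ⟪deltaZ n, J (deltaZ m)⟫_ℂ = jacEntryZ a b n m) (m : ℤ) :
    J (deltaZ m) = (a (m - 1) : ℂ) • deltaZ (m - 1) + (b m : ℂ) • deltaZ m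
      + (a m : ℂ) • deltaZ (m + 1) := by
  refine lp.ext (funext fun n => ?_)
  rw [← inner_deltaZ, hJ]
  simp only [lp.coeFn_add, lp.coeFn_smul, Pi.add_apply, Pi.smul_apply, deltaZ_apply, smul_eq_mul,
    jacEntryZ]
  split_ifs with h1 h2 <;> first | omega | skip
  all_goals first | (subst h1; simp) | simp_all

theorem jacobiN_apply_succ {a b : ℕ → ℝ} {J : ℓN →L[ℂ] ℓN} (hJsa : IsSelfAdjoint J)
    (hJ : ∀ n m, ⟪deltaN n, J (deltaN m)⟫_ℂ = jacEntryN a b n m) (u : ℓN) (n : ℕ) :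
    J u (n + 1) = a n * u n + b (n + 1) * u (n + 1) + a (n + 1) * u (n + 2) := by
  rw [← inner_deltaN, ← ContinuousLinearMap.adjoint_inner_left,
    ← ContinuousLinearMap.star_eq_adjoint, hJsa.star_eq, jacobiN_delta_succ hJ]
  simp only [inner_add_left, inner_smul_left, inner_deltaN, Complex.conj_ofReal]

theorem jacobiZ_isSelfAdjoint {a b : ℤ → ℝ} {J : ℓZ →L[ℂ] ℓZ}
    (hJ : ∀ n m, ⟪deltaZ n, J (deltaZ m)⟫_ℂ = jacEntryZ a b n m) : IsSelfAdjoint J := by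
  rw [isSelfAdjoint_iff, ContinuousLinearMap.star_eq_adjoint]
  refine lp.ext_continuousLinearMap (by norm_num) fun m => ContinuousLinearMap.ext_ring ?_
  refine lp.ext (funext fun n => ?_)
  change (ContinuousLinearMap.adjoint J (deltaZ m)) n = (J (deltaZ m)) n
  rw [← inner_deltaZ, ← inner_deltaZ, ContinuousLinearMap.adjoint_inner_right, hJ,
    ← inner_conj_symm, hJ]
  simp only [jacEntryZ]
  split_ifs <;> first | omega | (simp; done) | (subst_vars; simp)

theorem memℓp_mul_comp_equiv {c : ℤ → ℂ} {C : ℝ} (hc : ∀ n, ‖c n‖ ≤ C) (σ : ℤ ≃ ℤ) (u : ℓZ) :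
    Memℓp (fun n => c n * u (σ n)) 2 := by
  refine memℓp_gen ?_
  have h1 : Summable fun n => C ^ 2 * ‖u (σ n)‖ ^ 2 :=
    ((σ.summable_iff (f := fun n => ‖u n‖ ^ 2)).mpr (hasSum_norm_sq u).summable).mul_left _
  refine Summable.of_nonneg_of_le (fun n => by positivity) (fun n => ?_) h1
  have : ‖c n * u (σ n)‖ ^ 2 ≤ C ^ 2 * ‖u (σ n)‖ ^ 2 := by
    rw [norm_mul, mul_pow]
    gcongr
    exact hc n
  simpa using this

theorem exists_mul_comp_equiv {c : ℤ → ℂ} {C : ℝ} (hc : ∀ n, ‖c n‖ ≤ C) (σ : ℤ ≃ ℤ) :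
    ∃ T : ℓZ →L[ℂ] ℓZ, ∀ u n, T u n = c n * u (σ n) := by
  have hC : 0 ≤ C := (norm_nonneg _).trans (hc 0)
  let T₀ : ℓZ →ₗ[ℂ] ℓZ :=
    { toFun := fun u => ⟨fun n => c n * u (σ n), memℓp_mul_comp_equiv hc σ u⟩
      map_add' := fun u v => lp.ext (funext fun n => mul_add _ _ _)
      map_smul' := fun r u => lp.ext (funext fun n => mul_left_comm _ _ _) }
  refine ⟨T₀.mkContinuous C fun u => ?_, fun u n => rfl⟩
  refine le_of_sq_le_sq ?_ (by positivity)
  rw [mul_pow]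
  refine hasSum_le (fun n => ?_) (hasSum_norm_sq (T₀ u))
    ((σ.hasSum_iff.mpr (hasSum_norm_sq u)).mul_left (C ^ 2))
  change ‖c n * u (σ n)‖ ^ 2 ≤ C ^ 2 * ‖u (σ n)‖ ^ 2
  rw [norm_mul, mul_pow]
  gcongr
  exact hc n

theorem exists_jacobiZ {a b : ℤ → ℝ} {K : ℝ} (ha : ∀ n, |a n| ≤ K) (hb : ∀ n, |b n| ≤ K) :
    ∃ J : ℓZ →L[ℂ] ℓZ, ∀ n m, ⟪deltaZ n, J (deltaZ m)⟫_ℂ = jacEntryZ a b n m := by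
  obtain ⟨S, hS⟩ := exists_mul_comp_equiv (c := fun n => (a n : ℂ)) (C := K)
    (by simpa using ha) (Equiv.addRight 1)
  obtain ⟨S', hS'⟩ := exists_mul_comp_equiv (c := fun n => (a (n - 1) : ℂ)) (C := K)
    (by simpa using fun n => ha (n - 1)) (Equiv.subRight 1)
  obtain ⟨D, hD⟩ := exists_mul_comp_equiv (c := fun n => (b n : ℂ)) (C := K)
    (by simpa using hb) (Equiv.refl ℤ)
  refine ⟨S + S' + D, fun n m => ?_⟩
  rw [inner_deltaZ]
  simp only [add_apply, lp.coeFn_add, Pi.add_apply, hS, hS', hD, deltaZ_apply,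
    jacEntryZ, Equiv.coe_addRight, Equiv.subRight_apply, Equiv.refl_apply]
  split_ifs <;> first | omega | simp_all

theorem tendsto_inner_deltaN {n : ℕ → ℕ} (hn : Tendsto n atTop atTop) (l m : ℤ) :
    Tendsto (fun j => ⟪deltaN ((n j : ℤ) + l).toNat, deltaN ((n j : ℤ) + m).toNat⟫_ℂ) atTop
      (nhds ⟪deltaZ l, deltaZ m⟫_ℂ) := by
  refine tendsto_const_nhds.congr' ?_
  filter_upwards [hn.eventually_ge_atTop (l.natAbs + m.natAbs)] with j hj
  rw [inner_deltaN, inner_deltaZ, deltaN_apply, deltaZ_apply]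
  congr 1
  rw [eq_iff_iff]
  omega

theorem tendsto_inner_jacobi {a b : ℕ → ℝ} {ar br : ℤ → ℝ} {J : ℓN →L[ℂ] ℓN} {Jr : ℓZ →L[ℂ] ℓZ}
    (hJ : ∀ n m, ⟪deltaN n, J (deltaN m)⟫_ℂ = jacEntryN a b n m)
    (hJr : ∀ n m, ⟪deltaZ n, Jr (deltaZ m)⟫_ℂ = jacEntryZ ar br n m)
    {n : ℕ → ℕ} (hn : Tendsto n atTop atTop)
    (ha : ∀ l : ℤ, Tendsto (fun j => a ((n j : ℤ) + l).toNat) atTop (nhds (ar l)))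
    (hb : ∀ l : ℤ, Tendsto (fun j => b ((n j : ℤ) + l).toNat) atTop (nhds (br l)))
    (z : ℂ) (l m : ℤ) :
    Tendsto (fun j =>
      ⟪J (deltaN ((n j : ℤ) + l).toNat) - z • deltaN ((n j : ℤ) + l).toNat,
        J (deltaN ((n j : ℤ) + m).toNat) - z • deltaN ((n j : ℤ) + m).toNat⟫_ℂ) atTop
      (nhds ⟪Jr (deltaZ l) - z • deltaZ l, Jr (deltaZ m) - z • deltaZ m⟫_ℂ) := by
  have hexp : ∀ l : ℤ, ∀ᶠ j in atTop, J (deltaN ((n j : ℤ) + l).toNat) =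
      (a ((n j : ℤ) + (l - 1)).toNat : ℂ) • deltaN ((n j : ℤ) + (l - 1)).toNat
      + (b ((n j : ℤ) + l).toNat : ℂ) • deltaN ((n j : ℤ) + l).toNat
      + (a ((n j : ℤ) + l).toNat : ℂ) • deltaN ((n j : ℤ) + (l + 1)).toNat := fun l => by
    filter_upwards [hn.eventually_ge_atTop (l.natAbs + 1)] with j hj
    obtain ⟨k, hk⟩ : ∃ k : ℕ, (n j : ℤ) + l = k + 1 := ⟨((n j : ℤ) + l - 1).toNat, by omega⟩
    rw [show ((n j : ℤ) + l).toNat = k + 1 by omega,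
      show ((n j : ℤ) + (l - 1)).toNat = k by omega,
      show ((n j : ℤ) + (l + 1)).toNat = k + 2 by omega]
    exact jacobiN_delta_succ hJ k
  have ha' : ∀ l : ℤ, Tendsto (fun j => (a ((n j : ℤ) + l).toNat : ℂ)) atTop (nhds (ar l : ℂ)) :=
    fun l => (Complex.continuous_ofReal.tendsto _).comp (ha l)
  have hb' : ∀ l : ℤ, Tendsto (fun j => (b ((n j : ℤ) + l).toNat : ℂ)) atTop (nhds (br l : ℂ)) :=
    fun l => (Complex.continuous_ofReal.tendsto _).comp (hb l)
  have he := tendsto_inner_deltaN hn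
  rw [jacobiZ_delta hJr l, jacobiZ_delta hJr m]
  refine Tendsto.congr' (f₁ := fun j => inner ℂ
    ((a ((n j : ℤ) + (l - 1)).toNat : ℂ) • deltaN ((n j : ℤ) + (l - 1)).toNat
      + (b ((n j : ℤ) + l).toNat : ℂ) • deltaN ((n j : ℤ) + l).toNat
      + (a ((n j : ℤ) + l).toNat : ℂ) • deltaN ((n j : ℤ) + (l + 1)).toNat
      - z • deltaN ((n j : ℤ) + l).toNat)
    ((a ((n j : ℤ) + (m - 1)).toNat : ℂ) • deltaN ((n j : ℤ) + (m - 1)).toNat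
      + (b ((n j : ℤ) + m).toNat : ℂ) • deltaN ((n j : ℤ) + m).toNat
      + (a ((n j : ℤ) + m).toNat : ℂ) • deltaN ((n j : ℤ) + (m + 1)).toNat
      - z • deltaN ((n j : ℤ) + m).toNat)) ?_ ?_
  · filter_upwards [hexp l, hexp m] with j h1 h2
    rw [h1, h2]
  · simp only [inner_add_left, inner_add_right, inner_sub_left, inner_sub_right, inner_smul_left,
      inner_smul_right, Complex.conj_ofReal]
    repeat' first
      | exact he _ _
      | exact ha' _
      | exact hb' _
      | exact tendsto_const_nhds
      | apply Tendsto.add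
      | apply Tendsto.sub
      | apply Tendsto.mul

theorem norm_deltaN (n : ℕ) : ‖deltaN n‖ = 1 := by
  rw [deltaN, lp.norm_single (by norm_num), norm_one]

theorem tendsto_inner_deltaN_zero (h : ℓN) :
    Tendsto (fun k => ⟪h, deltaN k⟫_ℂ) atTop (nhds 0) := by
  have h1 : Tendsto (fun k => ‖h k‖ ^ 2) atTop (nhds 0) :=
    (hasSum_norm_sq h).summable.tendsto_atTop_zero
  have h2 : Tendsto (fun k => ‖h k‖) atTop (nhds 0) := by
    have := (Real.continuous_sqrt.tendsto 0).comp h1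
    simpa only [Function.comp_def, Real.sqrt_sq (norm_nonneg _), Real.sqrt_zero] using this
  refine tendsto_zero_iff_norm_tendsto_zero.mpr (h2.congr fun k => ?_)
  rw [norm_inner_symm, inner_deltaN]

theorem dense_deltaZ {p : ℓZ → Prop} (hp : IsClosed {v | p v})
    (h : ∀ (s : Finset ℤ) (c : ℤ → ℂ), p (∑ l ∈ s, c l • deltaZ l)) (v : ℓZ) : p v := by
  have hs : HasSum (fun l => lp.single 2 l (v l)) v := lp.hasSum_single (by norm_num) v
  refine hp.mem_of_tendsto hs (Eventually.of_forall fun s => ?_)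
  have := h s v
  change p _
  simpa only [deltaZ, ← lp.single_smul, smul_eq_mul, mul_one] using this

theorem map_sum_smul_sub_smul {ι E : Type*} [NormedAddCommGroup E] [NormedSpace ℂ E]
    (T : E →L[ℂ] E) (z : ℂ) (s : Finset ι) (c : ι → ℂ) (x : ι → E) :
    T (∑ i ∈ s, c i • x i) - z • ∑ i ∈ s, c i • x i = ∑ i ∈ s, c i • (T (x i) - z • x i) := by
  simp only [map_sum, map_smul, Finset.smul_sum, smul_sub, Finset.sum_sub_distrib, smul_comm z]

theorem spectrum_rightLimit_subset_essSpec {a b : ℕ → ℝ} {ar br : ℤ → ℝ}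
    {J : ℓN →L[ℂ] ℓN} {Jr : ℓZ →L[ℂ] ℓZ}
    (hJ : ∀ n m, ⟪deltaN n, J (deltaN m)⟫_ℂ = jacEntryN a b n m)
    (hJr : ∀ n m, ⟪deltaZ n, Jr (deltaZ m)⟫_ℂ = jacEntryZ ar br n m)
    (hlim : IsRightLimit a b ar br) : spectrum ℂ Jr ⊆ essSpec J := by
  intro z hz
  refine Set.mem_iInter.mpr fun ⟨C, hC⟩ => ?_
  by_contra hzC
  obtain ⟨c, hc, hbound⟩ := exists_bound_of_notMem_spectrum hzC
  obtain ⟨n, hn, hab⟩ := hlim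
  refine (jacobiZ_isSelfAdjoint hJr).notMem_spectrum_of_bounded_below hc ?_ hz
  refine dense_deltaZ (isClosed_le (by fun_prop) (by fun_prop)) fun s d => ?_
  have h1 := tendsto_norm_sum_smul s
    (tendsto_inner_jacobi hJ hJr hn.tendsto_atTop (fun l => (hab l).1) (fun l => (hab l).2) z)
    (c := fun _ => d) fun i => tendsto_const_nhds
  have h2 := tendsto_norm_sum_smul s (tendsto_inner_deltaN hn.tendsto_atTop)
    (c := fun _ => d) fun i => tendsto_const_nhds
  rw [← map_sum_smul_sub_smul Jr z s d deltaZ] at h1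
  replace h1 := h1.congr fun j => congrArg norm (map_sum_smul_sub_smul J z s d _).symm
  have h3 : Tendsto (fun j => ‖C (∑ i ∈ s, d i • deltaN ((n j : ℤ) + i).toNat)‖) atTop
      (nhds 0) := by
    have hk := IsCompactOperator.tendsto_zero_of_weakly_tendsto_zero hC
      (fun k => (norm_deltaN k).le) tendsto_inner_deltaN_zero
    have ht : ∀ i : ℤ, Tendsto (fun j => ((n j : ℤ) + i).toNat) atTop atTop := fun i => by
      refine tendsto_atTop.mpr fun M => ?_
      filter_upwards [hn.tendsto_atTop.eventually_ge_atTop (M + i.natAbs)] with j hj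
      omega
    have := tendsto_finsetSum s fun i _ => (hk.comp (ht i)).const_smul (d i)
    simpa using this.norm
  have h4 := h1.add h3
  rw [add_zero] at h4
  refine le_of_tendsto_of_tendsto' (h2.const_mul c) h4 fun j => ?_
  refine (hbound _).trans ?_
  rw [add_apply, add_sub_right_comm]
  exact norm_add_le _ _

theorem window_commutator {a b : ℕ → ℝ} {J : ℓN →L[ℂ] ℓN} (hJsa : IsSelfAdjoint J)
    (hJ : ∀ n m, ⟪deltaN n, J (deltaN m)⟫_ℂ = jacEntryN a b n m) (z : ℂ) (u : ℓN) (j L : ℕ) :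
    J (∑ i ∈ Finset.range L, u (j + 1 + i) • deltaN (j + 1 + i))
        - z • ∑ i ∈ Finset.range L, u (j + 1 + i) • deltaN (j + 1 + i)
      = ∑ i ∈ Finset.range L, (J u - z • u) (j + 1 + i) • deltaN (j + 1 + i)
        + ((a j * u (j + 1)) • deltaN j - (a j * u j) • deltaN (j + 1)
          - (a (j + L) * u (j + L + 1)) • deltaN (j + L)
          + (a (j + L) * u (j + L)) • deltaN (j + L + 1)) := by
  induction L with
  | zero => simp
  | succ L ih =>
    rw [Finset.sum_range_succ, Finset.sum_range_succ, map_add, smul_add, add_sub_add_comm, ih,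
      map_smul, show j + 1 + L = j + L + 1 by ring, jacobiN_delta_succ hJ]
    have hw : (J u - z • u) (j + L + 1) = a (j + L) * u (j + L)
        + b (j + L + 1) * u (j + L + 1) + a (j + L + 1) * u (j + L + 2) - z * u (j + L + 1) := by
      rw [← jacobiN_apply_succ hJsa hJ]
      rfl
    rw [hw, ← add_assoc j L 1, show j + L + 1 + 1 = j + L + 2 by ring]
    module

theorem norm_window_commutator_sq_le {a b : ℕ → ℝ} {K : ℝ} (ha : ∀ n, |a n| ≤ K)
    {J : ℓN →L[ℂ] ℓN} (hJsa : IsSelfAdjoint J)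
    (hJ : ∀ n m, ⟪deltaN n, J (deltaN m)⟫_ℂ = jacEntryN a b n m) (z : ℂ) (u : ℓN) (j L : ℕ) :
    ‖J (∑ i ∈ Finset.range L, u (j + 1 + i) • deltaN (j + 1 + i))
        - z • ∑ i ∈ Finset.range L, u (j + 1 + i) • deltaN (j + 1 + i)‖ ^ 2
      ≤ 2 * ∑ i ∈ Finset.range L, ‖(J u - z • u) (j + 1 + i)‖ ^ 2
        + 8 * K ^ 2 * (‖u j‖ ^ 2 + ‖u (j + 1)‖ ^ 2 + ‖u (j + L)‖ ^ 2 + ‖u (j + L + 1)‖ ^ 2) := by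
  rw [window_commutator hJsa hJ]
  have hterm : ∀ n m k : ℕ, ‖((a n : ℂ) * u m) • deltaN k‖ ≤ K * ‖u m‖ := fun n m k => by
    rw [norm_smul, norm_deltaN, mul_one, norm_mul, Complex.norm_real, Real.norm_eq_abs]
    exact mul_le_mul_of_nonneg_right (ha n) (norm_nonneg _)
  have hsum : ∑ i ∈ Finset.range L, ‖(J u - z • u) (j + 1 + i)‖ ^ 2
      = ‖∑ i ∈ Finset.range L, (J u - z • u) (j + 1 + i) • deltaN (j + 1 + i)‖ ^ 2 := by
    have h1 := norm_sum_deltaN_sq (Finset.Ico (j + 1) (j + 1 + L)) (J u - z • u)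
    rw [Finset.sum_Ico_eq_sum_range, Finset.sum_Ico_eq_sum_range, Nat.add_sub_cancel_left] at h1
    exact h1.symm
  rw [hsum]
  set X := ∑ i ∈ Finset.range L, (J u - z • u) (j + 1 + i) • deltaN (j + 1 + i)
  have hE := (norm_add_le (((a j : ℂ) * u (j + 1)) • deltaN j - ((a j : ℂ) * u j) • deltaN (j + 1)
      - ((a (j + L) : ℂ) * u (j + L + 1)) • deltaN (j + L))
      (((a (j + L) : ℂ) * u (j + L)) • deltaN (j + L + 1))).trans
    (add_le_add ((norm_sub_le _ _).trans
      (add_le_add ((norm_sub_le _ _).trans (add_le_add (hterm _ _ _) (hterm _ _ _)))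
        (hterm _ _ _))) (hterm _ _ _))
  set E := ((a j : ℂ) * u (j + 1)) • deltaN j - ((a j : ℂ) * u j) • deltaN (j + 1)
      - ((a (j + L) : ℂ) * u (j + L + 1)) • deltaN (j + L)
      + ((a (j + L) : ℂ) * u (j + L)) • deltaN (j + L + 1)
  have hE2 : ‖E‖ ^ 2 ≤ 4 * K ^ 2 *
      (‖u j‖ ^ 2 + ‖u (j + 1)‖ ^ 2 + ‖u (j + L)‖ ^ 2 + ‖u (j + L + 1)‖ ^ 2) := by
    refine (pow_le_pow_left₀ (norm_nonneg _) hE 2).trans ?_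
    generalize ‖u j‖ = p
    generalize ‖u (j + 1)‖ = q
    generalize ‖u (j + L)‖ = r
    generalize ‖u (j + L + 1)‖ = s
    nlinarith [sq_nonneg (K * (p - q)), sq_nonneg (K * (p - r)), sq_nonneg (K * (p - s)),
      sq_nonneg (K * (q - r)), sq_nonneg (K * (q - s)), sq_nonneg (K * (r - s))]
  have hXE : ‖X + E‖ ^ 2 ≤ 2 * ‖X‖ ^ 2 + 2 * ‖E‖ ^ 2 := by
    have := pow_le_pow_left₀ (norm_nonneg _) (norm_add_le X E) 2
    nlinarith [sq_nonneg (‖X‖ - ‖E‖)]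
  linarith

theorem sum_windows_le {f g : ℕ → ℝ} {F G δ C : ℝ} (hg : ∀ n, 0 ≤ g n)
    (hfF : HasSum f F) (hgG : HasSum g G) {L N : ℕ}
    (hvan : ∀ n < N + L + 1, f n = 0)
    (h : ∀ j ≥ N, δ * ∑ i ∈ Finset.range L, f (j + 1 + i)
      ≤ 2 * ∑ i ∈ Finset.range L, g (j + 1 + i)
        + C * (f j + f (j + 1) + f (j + L) + f (j + L + 1))) :
    δ * (L * F) ≤ 2 * (L * G) + 4 * C * F := by
  have hshift : ∀ {e : ℕ → ℝ} {E : ℝ}, HasSum e E → ∀ m,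
      HasSum (fun k => e (k + m)) (E - ∑ i ∈ Finset.range m, e i) := fun he m =>
    (hasSum_nat_add_iff' m).mpr he
  have hf' : ∀ m < N + L + 2, HasSum (fun k => f (k + m)) F := fun m hm => by
    have := hshift hfF m
    rwa [Finset.sum_eq_zero fun i hi => hvan i (by rw [Finset.mem_range] at hi; omega),
      sub_zero] at this
  have h1 : HasSum (fun k => δ * ∑ i ∈ Finset.range L, f (k + (N + 1 + i))) (δ * (L * F)) := by
    have := hasSum_sum fun i (hi : i ∈ Finset.range L) =>
      hf' (N + 1 + i) (by rw [Finset.mem_range] at hi; omega)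
    rw [Finset.sum_const, Finset.card_range, nsmul_eq_mul] at this
    exact this.mul_left δ
  have h2 : HasSum (fun k => ∑ i ∈ Finset.range L, g (k + (N + 1 + i)))
      (∑ i ∈ Finset.range L, (G - ∑ l ∈ Finset.range (N + 1 + i), g l)) :=
    hasSum_sum fun i _ => hshift hgG _
  have h2le : ∑ i ∈ Finset.range L, (G - ∑ l ∈ Finset.range (N + 1 + i), g l) ≤ L * G := by
    refine (Finset.sum_le_card_nsmul _ _ G fun i _ => ?_).trans (by simp)
    exact sub_le_self _ (Finset.sum_nonneg fun l _ => hg l)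
  have h3 := ((((hf' N (by omega)).add (hf' (N + 1) (by omega))).add
    (hf' (N + L) (by omega))).add (hf' (N + L + 1) (by omega))).mul_left C
  have := hasSum_le (fun k => ?_) h1 ((h2.mul_left 2).add h3)
  · linarith
  · have := h (k + N) (by omega)
    simpa only [add_assoc] using this

theorem bounded_below_of_windows {a b : ℕ → ℝ} {K : ℝ} (ha : ∀ n, |a n| ≤ K)
    {J : ℓN →L[ℂ] ℓN} (hJsa : IsSelfAdjoint J)
    (hJ : ∀ n m, ⟪deltaN n, J (deltaN m)⟫_ℂ = jacEntryN a b n m) {z : ℂ} {δ : ℝ} (hδ : 0 < δ)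
    {L N : ℕ} (hL : 64 * K ^ 2 ≤ δ ^ 2 * L) (hL0 : 0 < L)
    (h : ∀ j ≥ N, ∀ c : ℕ → ℂ, δ * ‖∑ i ∈ Finset.range L, c i • deltaN (j + i)‖
      ≤ ‖J (∑ i ∈ Finset.range L, c i • deltaN (j + i))
        - z • ∑ i ∈ Finset.range L, c i • deltaN (j + i)‖)
    {u : ℓN} (hu : ∀ n < N + L + 1, u n = 0) : δ / 2 * ‖u‖ ≤ ‖J u - z • u‖ := by
  have key := sum_windows_le (f := fun n => ‖u n‖ ^ 2) (g := fun n => ‖(J u - z • u) n‖ ^ 2)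
    (δ := δ ^ 2) (C := 8 * K ^ 2) (L := L) (N := N) (fun n => by positivity)
    (hasSum_norm_sq u) (hasSum_norm_sq _)
    (fun n hn => by simp [hu n hn]) fun j hj => by
      refine le_trans ?_ (norm_window_commutator_sq_le ha hJsa hJ z u j L)
      have h1 := norm_sum_deltaN_sq (Finset.Ico (j + 1) (j + 1 + L)) u
      rw [Finset.sum_Ico_eq_sum_range, Finset.sum_Ico_eq_sum_range, Nat.add_sub_cancel_left] at h1
      rw [← h1, ← mul_pow]
      exact pow_le_pow_left₀ (by positivity) (h (j + 1) (by omega) fun i => u (j + 1 + i)) 2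
  have hLpos : (0 : ℝ) < L := by exact_mod_cast hL0
  refine le_of_sq_le_sq ?_ (norm_nonneg _)
  refine le_of_mul_le_mul_left ?_ hLpos
  nlinarith [mul_le_mul_of_nonneg_right hL (sq_nonneg ‖u‖)]

theorem exists_windows_bound {a b : ℕ → ℝ} {K : ℝ} (ha : ∀ n, |a n| ≤ K) (hb : ∀ n, |b n| ≤ K)
    {J : ℓN →L[ℂ] ℓN} (hJ : ∀ n m, ⟪deltaN n, J (deltaN m)⟫_ℂ = jacEntryN a b n m)
    {z : ℂ} {ε δ : ℝ} (hδε : δ < ε)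
    (h : ∀ ar br, IsRightLimit a b ar br → ∀ Jr : ℓZ →L[ℂ] ℓZ,
      (∀ n m, ⟪deltaZ n, Jr (deltaZ m)⟫_ℂ = jacEntryZ ar br n m) →
      ∀ v, ε * ‖v‖ ≤ ‖Jr v - z • v‖) (L : ℕ) :
    ∃ N, ∀ j ≥ N, ∀ c : ℕ → ℂ, δ * ‖∑ i ∈ Finset.range L, c i • deltaN (j + i)‖
      ≤ ‖J (∑ i ∈ Finset.range L, c i • deltaN (j + i))
        - z • ∑ i ∈ Finset.range L, c i • deltaN (j + i)‖ := by
  by_contra! hcon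
  have hnorm : ∀ N, ∃ j ≥ N, ∃ c : ℕ → ℂ, (∀ i, ‖c i‖ ≤ 1) ∧
      ‖∑ i ∈ Finset.range L, c i • deltaN (j + i)‖ = 1 ∧
      ‖J (∑ i ∈ Finset.range L, c i • deltaN (j + i))
        - z • ∑ i ∈ Finset.range L, c i • deltaN (j + i)‖ ≤ δ := fun N => by
    obtain ⟨j, hj, c, hc⟩ := hcon N
    set v := ∑ i ∈ Finset.range L, c i • deltaN (j + i) with hv
    have hv0 : 0 < ‖v‖ := norm_pos_iff.mpr fun h0 => by simp [h0] at hc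
    set r : ℂ := ((‖v‖⁻¹ : ℝ) : ℂ)
    have hr : ‖r‖ = ‖v‖⁻¹ := by simp [r]
    have hsum : ∑ i ∈ Finset.range L, (if i < L then r * c i else 0) • deltaN (j + i) = r • v := by
      rw [hv, Finset.smul_sum]
      refine Finset.sum_congr rfl fun i hi => ?_
      rw [if_pos (Finset.mem_range.mp hi), mul_smul]
    have hvsq : ‖v‖ ^ 2 = ∑ i ∈ Finset.range L, ‖c i‖ ^ 2 := by
      have h1 := norm_sum_deltaN_sq (Finset.Ico j (j + L)) fun k => c (k - j)
      rw [Finset.sum_Ico_eq_sum_range, Finset.sum_Ico_eq_sum_range] at h1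
      simpa using h1
    refine ⟨j, hj, fun i => if i < L then r * c i else 0, fun i => ?_, ?_, ?_⟩
    · dsimp only
      split_ifs with hi
      · rw [norm_mul, hr, inv_mul_le_iff₀ hv0, mul_one]
        refine le_of_sq_le_sq ?_ hv0.le
        rw [hvsq]
        exact Finset.single_le_sum (f := fun i => ‖c i‖ ^ 2) (fun i _ => by positivity)
          (Finset.mem_range.mpr hi)
      · simp
    · rw [hsum, norm_smul, hr, inv_mul_cancel₀ hv0.ne']
    · rw [hsum, map_smul, smul_comm z, ← smul_sub, norm_smul, hr, inv_mul_le_iff₀ hv0, mul_comm]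
      exact hc.le
  choose n hn c hc1 hc2 hc3 using hnorm
  have hcomp : IsCompact ((Set.univ.pi fun _ : ℤ => Set.Icc (-K) K) ×ˢ
      ((Set.univ.pi fun _ : ℤ => Set.Icc (-K) K) ×ˢ
        (Set.univ.pi fun _ : ℕ => Metric.closedBall (0 : ℂ) 1))) :=
    (isCompact_univ_pi fun _ => isCompact_Icc).prod
      ((isCompact_univ_pi fun _ => isCompact_Icc).prod
        (isCompact_univ_pi fun _ => isCompact_closedBall _ _))
  obtain ⟨⟨ar, br, d⟩, hmem, φ, hφ, hlim⟩ := hcomp.tendsto_subseq (x := fun N =>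
    (fun l : ℤ => a ((n N : ℤ) + l).toNat, fun l : ℤ => b ((n N : ℤ) + l).toNat, c N))
    fun N => ⟨fun l _ => abs_le.mp (ha _), fun l _ => abs_le.mp (hb _),
      fun i _ => by simpa using hc1 N i⟩
  have hnt : Tendsto (fun N => n (φ N)) atTop atTop :=
    (tendsto_atTop_mono hn tendsto_id).comp hφ.tendsto_atTop
  have har := tendsto_pi_nhds.mp ((continuous_fst.tendsto _).comp hlim)
  have hbr := tendsto_pi_nhds.mp (((continuous_fst.comp continuous_snd).tendsto _).comp hlim)
  have hd : ∀ i, Tendsto (fun N => c (φ N) i) atTop (nhds (d i)) := tendsto_pi_nhds.mp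
    (((continuous_snd.comp continuous_snd).tendsto _).comp hlim)
  obtain ⟨ψ, hψ, hnψ⟩ := strictMono_subseq_of_tendsto_atTop hnt
  have hright : IsRightLimit a b ar br :=
    ⟨fun N => n (φ (ψ N)), hnψ, fun l =>
      ⟨(har l).comp hψ.tendsto_atTop, (hbr l).comp hψ.tendsto_atTop⟩⟩
  obtain ⟨Jr, hJr⟩ := exists_jacobiZ (a := ar) (b := br) (fun l => abs_le.mpr (hmem.1 l trivial))
    (fun l => abs_le.mpr (hmem.2.1 l trivial))
  have h1 := tendsto_norm_sum_smul (Finset.range L)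
    (fun i k => tendsto_inner_jacobi hJ hJr hnt har hbr z (i : ℤ) (k : ℤ)) hd
  have h2 := tendsto_norm_sum_smul (Finset.range L)
    (fun i k => tendsto_inner_deltaN hnt (i : ℤ) (k : ℤ)) hd
  rw [← map_sum_smul_sub_smul Jr z (Finset.range L) d fun i => deltaZ i] at h1
  replace h1 := h1.congr fun N =>
    congrArg norm (map_sum_smul_sub_smul J z (Finset.range L) (c (φ N)) _).symm
  have hcast : ∀ p q : ℕ, ((p : ℤ) + q).toNat = p + q := fun p q => by omega
  simp only [hcast] at h1 h2
  have h3 := h ar br hright Jr hJr (∑ i ∈ Finset.range L, d i • deltaZ i)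
  have h4 := tendsto_nhds_unique h2 (tendsto_const_nhds.congr fun N => (hc2 (φ N)).symm)
  rw [h4, mul_one] at h3
  have h5 := le_of_tendsto' h1 fun N => hc3 (φ N)
  linarith

end Jacobi

/-- **(Last–Simon, Theorem 1.6.)**  For a bounded self-adjoint Jacobi matrix `J` with
`sup|b_n| + sup|a_n| + sup|a_n|⁻¹ ≤ K`, the essential spectrum of `J` equals the closure of
the union of the spectra of all right limits of `J`. -/
theorem stmt9 (a b : ℕ → ℝ) (K : ℝ) (ha : ∀ n, 0 < a n)
    (hK : ∀ n, |b n| + |a n| + (a n)⁻¹ ≤ K)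
    (J : lp (fun _ : ℕ => ℂ) 2 →L[ℂ] lp (fun _ : ℕ => ℂ) 2)
    (hJsa : IsSelfAdjoint J)
    (hJ : ∀ n m, ⟪deltaN n, J (deltaN m)⟫_ℂ = jacEntryN a b n m) :
    essSpec J =
      closure (⋃ ar : ℤ → ℝ, ⋃ br : ℤ → ℝ, ⋃ _ : IsRightLimit a b ar br,
        ⋃ Jr : lp (fun _ : ℤ => ℂ) 2 →L[ℂ] lp (fun _ : ℤ => ℂ) 2,
        ⋃ _ : (∀ n m, ⟪deltaZ n, Jr (deltaZ m)⟫_ℂ = jacEntryZ ar br n m),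
        spectrum ℂ Jr) := by
  have haK : ∀ n, |a n| ≤ K := fun n => by
    have := hK n
    have := inv_pos.mpr (ha n)
    linarith [abs_nonneg (b n)]
  have hbK : ∀ n, |b n| ≤ K := fun n => by
    have := hK n
    have := inv_pos.mpr (ha n)
    linarith [abs_nonneg (a n)]
  refine Set.Subset.antisymm (fun z hz => ?_) (closure_minimal ?_ ?_)
  · by_contra hcl
    obtain ⟨ε, hε, hdist⟩ : ∃ ε > 0, ∀ w ∈ _, ε ≤ dist z w := by
      simpa only [Metric.mem_closure_iff, not_forall, not_exists, not_and, not_lt,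
        exists_prop] using hcl
    have hlow : ∀ ar br, IsRightLimit a b ar br → ∀ Jr : lp (fun _ : ℤ => ℂ) 2 →L[ℂ] _,
        (∀ n m, ⟪deltaZ n, Jr (deltaZ m)⟫_ℂ = jacEntryZ ar br n m) →
        ∀ v, ε * ‖v‖ ≤ ‖Jr v - z • v‖ := fun ar br hr Jr hJr v =>
      (jacobiZ_isSelfAdjoint hJr).mul_norm_le_norm_sub_smul hε (fun w hw => hdist w (by
        simp only [Set.mem_iUnion]
        exact ⟨ar, br, hr, Jr, hJr, hw⟩)) v
    obtain ⟨L, hL⟩ := exists_nat_ge (64 * K ^ 2 / (ε / 2) ^ 2 + 1)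
    have hL0 : 0 < L := by
      have : (0 : ℝ) < L := lt_of_lt_of_le (by positivity) hL
      exact_mod_cast this
    have hL' : 64 * K ^ 2 ≤ (ε / 2) ^ 2 * L := by
      rw [← div_le_iff₀' (by positivity)]
      linarith
    obtain ⟨N, hN⟩ := exists_windows_bound haK hbK hJ (half_lt_self hε) hlow L
    let V : Submodule ℂ (lp (fun _ : ℕ => ℂ) 2) :=
      Submodule.span ℂ (deltaN '' Set.Iio (N + L + 1))
    have : FiniteDimensional ℂ V :=
      FiniteDimensional.span_of_finite ℂ ((Set.finite_Iio _).image _)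
    refine notMem_essSpec_of_bounded_below_orthogonal hJsa V (c := ε / 2 / 2) (by positivity)
      (fun u hu => ?_) hz
    refine bounded_below_of_windows haK hJsa hJ (by positivity) hL' hL0 hN fun n hn => ?_
    rw [← inner_deltaN]
    exact Submodule.inner_right_of_mem_orthogonal
      (Submodule.subset_span (Set.mem_image_of_mem _ hn)) hu
  · simp only [Set.iUnion_subset_iff]
    exact fun ar br hr Jr hJr => spectrum_rightLimit_subset_essSpec hJ hJr hr
  · exact isClosed_iInter fun C => spectrum.isClosed _
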